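/- arXiv:2410.05493 — 2 statements merged into one kernel-verified Lean document; each statement's English description precedes it below -/
import Mathlib

section
/- Fix a position i and 1 ≤ l ≤ D, and suppose Σ_{q∈𝒜} 𝐧_{i,s_{i,j}}(q) > 0 for all 0 ≤ j ≤ l. Then the counting vector of the length-l suffix is recoverable from the forward and backward statistics: for every a ∈ 𝒜, 𝐧_{i,s_{i,l}}(a) = g_{i,s_{i,l}}(a) · (Π_{j=0}^{l−1} g^←_{i−1,s_{i,j}}(x_{i−j})) · i. In particular Σ_{q∈𝒜} 𝐧_{i,s_{i,0}}(q) = i for the empty suffix s_{i,0} = (). -/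
open scoped Classical

noncomputable section

variable {𝒜 : Type*}

/-- The finset of all strings over `𝒜` of length at most `D`. -/
def stringsLe (𝒜 : Type*) [Fintype 𝒜] (D : ℕ) : Finset (List 𝒜) :=
  Set.Finite.toFinset (List.finite_length_le 𝒜 D)

/-- A context tree of maximum depth `D`, identified with its leaf set: every leaf has length
at most `D`, no leaf is a (proper) suffix of another, and every string of length `D` has
exactly one suffix among the leaves. -/
def IsContextTree (D : ℕ) (T : Finset (List 𝒜)) : Prop :=
  (∀ s ∈ T, s.length ≤ D) ∧
  (∀ s ∈ T, ∀ t ∈ T, s <:+ t → s = t) ∧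
  (∀ w : List 𝒜, w.length = D → ∃! s, s ∈ T ∧ s <:+ w)

/-- The finset of all context trees of maximum depth `D`. -/
def contextTrees (𝒜 : Type*) [Fintype 𝒜] (D : ℕ) : Finset (Finset (List 𝒜)) :=
  (stringsLe 𝒜 D).powerset.filter (IsContextTree D)

/-- The branching-process prior `π_D` on context trees. -/
def priorD [Fintype 𝒜] (lam : ℝ) (D : ℕ) (T : Finset (List 𝒜)) : ℝ :=
  (1 - lam) ^ ((T.card - 1) / (Fintype.card 𝒜 - 1)) *
    lam ^ (T.card - (T.filter (fun s => s.length = D)).card)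

/-- The window `(x_{1-D}, …, x_{j-1})`. -/
def window (x : ℤ → 𝒜) (D : ℕ) (j : ℕ) : List 𝒜 :=
  (List.range (D + j - 1)).map (fun i => x (1 - (D : ℤ) + (i : ℤ)))

/-- The counting vector `𝐧_{n,s}(a)`. -/
def cnt [DecidableEq 𝒜] (x : ℤ → 𝒜) (D n : ℕ) (s : List 𝒜) (a : 𝒜) : ℕ :=
  ((Finset.Icc 1 n).filter (fun (j : ℕ) => x (j : ℤ) = a ∧ s <:+ window x D j)).card

/-- The evidence value `P^e(m)` of a counting vector `m` under Dirichlet parameters `α`. -/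
def pEv [Fintype 𝒜] (α : 𝒜 → ℝ) (m : 𝒜 → ℕ) : ℝ :=
  (Real.Gamma (∑ a, α a) / Real.Gamma (∑ a, ((m a : ℝ) + α a))) *
    ∏ a, (Real.Gamma ((m a : ℝ) + α a) / Real.Gamma (α a))

/-- The evidence `p^e_{n,s}`. -/
def pE [Fintype 𝒜] [DecidableEq 𝒜] (α : 𝒜 → ℝ) (x : ℤ → 𝒜) (D n : ℕ) (s : List 𝒜) : ℝ :=
  pEv α (cnt x D n s)

/-- Auxiliary downward recursion for the CTW weighted probabilities, with fuel `k = D - |s|`. -/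
def pWaux [Fintype 𝒜] [DecidableEq 𝒜] (α : 𝒜 → ℝ) (lam : ℝ) (x : ℤ → 𝒜) (D n : ℕ) :
    ℕ → List 𝒜 → ℝ
  | 0, s => pE α x D n s
  | k + 1, s => lam * pE α x D n s + (1 - lam) * ∏ q, pWaux α lam x D n k (q :: s)

/-- The CTW weighted probability `p^w_{n,s}`. -/
def pW [Fintype 𝒜] [DecidableEq 𝒜] (α : 𝒜 → ℝ) (lam : ℝ) (x : ℤ → 𝒜) (D n : ℕ)
    (s : List 𝒜) : ℝ :=
  pWaux α lam x D n (D - s.length) s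

/-- The observed suffix `s_{n,l} = (x_{n-l+1}, …, x_n)` of length `l`. -/
def sfx (x : ℤ → 𝒜) (n : ℤ) (l : ℕ) : List 𝒜 :=
  (List.range l).map (fun i => x (n - (l : ℤ) + 1 + (i : ℤ)))

/-- The CTW mixture weight `ω_{n,l}`. -/
def omegaW [Fintype 𝒜] [DecidableEq 𝒜] (α : 𝒜 → ℝ) (lam : ℝ) (x : ℤ → 𝒜) (D n l : ℕ) : ℝ :=
  (∑ T ∈ (contextTrees 𝒜 D).filter (fun T => sfx x n l ∈ T),
      priorD lam D T * ∏ s ∈ T, pE α x D n s) / pW α lam x D n []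

/-- The per-suffix Bayesian predictor `p̄_{n,s}(a)`. -/
def pBar [Fintype 𝒜] [DecidableEq 𝒜] (α : 𝒜 → ℝ) (x : ℤ → 𝒜) (D n : ℕ) (s : List 𝒜)
    (a : 𝒜) : ℝ :=
  (α a + cnt x D n s a) / ∑ q, (α q + cnt x D n s q)

end

noncomputable section

/-- The forward statistics vector `g_{n,s}(a)`. -/
def gfwd {𝒜 : Type*} [Fintype 𝒜] [DecidableEq 𝒜] (x : ℤ → 𝒜) (D n : ℕ) (s : List 𝒜)
    (a : 𝒜) : ℝ :=
  (cnt x D n s a : ℝ) / ∑ q, (cnt x D n s q : ℝ)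

/-- The backward statistics vector `g^←_{n-1,s}(a)`. -/
def gbwd {𝒜 : Type*} [Fintype 𝒜] [DecidableEq 𝒜] (x : ℤ → 𝒜) (D n : ℕ) (s : List 𝒜)
    (a : 𝒜) : ℝ :=
  (∑ q, (cnt x D n (a :: s) q : ℝ)) / ∑ q, (cnt x D n s q : ℝ)

end

/-- The counts of the empty string add up to the number of positions. -/
theorem sum_cnt_nil {𝒜 : Type*} [Fintype 𝒜] [DecidableEq 𝒜] (x : ℤ → 𝒜) (D n : ℕ) :
    ∑ q, cnt x D n [] q = n := by
  have h := Finset.card_eq_sum_card_fiberwise (s := Finset.Icc 1 n) (t := Finset.univ)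
    (f := fun j : ℕ => x (j : ℤ)) (fun _ _ => Finset.mem_coe.2 (Finset.mem_univ _))
  simp only [Nat.card_Icc, Nat.add_sub_cancel] at h
  refine Eq.trans ?_ h.symm
  refine Finset.sum_congr rfl fun q _ => ?_
  simp only [cnt, List.nil_suffix, and_true]

/-- `sfx` without the monadic coercion of the index list to `List ℤ`. -/
theorem sfx_eq_map {𝒜 : Type*} (x : ℤ → 𝒜) (n : ℤ) (l : ℕ) :
    sfx x n l = (List.range l).map fun k : ℕ => x (n - l + 1 + k) := by
  simp [sfx, ← List.map_eq_flatMap, Function.comp_def]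

theorem sfx_zero {𝒜 : Type*} (x : ℤ → 𝒜) (n : ℤ) : sfx x n 0 = [] := by
  simp [sfx]

theorem sfx_succ {𝒜 : Type*} (x : ℤ → 𝒜) (n : ℤ) (l : ℕ) :
    sfx x n (l + 1) = x (n - l) :: sfx x n l := by
  simp only [sfx_eq_map, List.range_succ_eq_map, List.map_cons, List.map_map, List.cons.injEq]
  refine ⟨congrArg x (by push_cast; ring), List.map_congr_left fun k _ => congrArg x ?_⟩
  push_cast
  ring

/-- The backward statistics along the observed suffixes telescope to the relative total count. -/
theorem prod_gbwd_mul_eq_sum_cnt {𝒜 : Type*} [Fintype 𝒜] [DecidableEq 𝒜] (x : ℤ → 𝒜)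
    (D i l : ℕ) (hpos : ∀ j < l, 0 < ∑ q, cnt x D i (sfx x (i : ℤ) j) q) :
    (∏ j ∈ Finset.range l, gbwd x D i (sfx x (i : ℤ) j) (x ((i : ℤ) - (j : ℤ)))) * i =
      ∑ q, (cnt x D i (sfx x (i : ℤ) l) q : ℝ) := by
  induction l with
  | zero =>
    rw [Finset.prod_range_zero, one_mul, sfx_zero]
    exact_mod_cast (sum_cnt_nil x D i).symm
  | succ l ih =>
    have hne : (∑ q, (cnt x D i (sfx x (i : ℤ) l) q : ℝ)) ≠ 0 := by
      exact_mod_cast (hpos l l.lt_succ_self).ne'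
    rw [Finset.prod_range_succ, mul_right_comm, ih fun j hj => hpos j (hj.trans l.lt_succ_self),
      gbwd, ← sfx_succ, mul_div_cancel₀ _ hne]

/-- The counting vector of the length-`l` observed suffix is recoverable from
the forward and backward statistics; in particular, the total count of the empty suffix is `i`. -/
theorem cnt_from_forward_backward_statistics {𝒜 : Type*} [Fintype 𝒜] [DecidableEq 𝒜]
    (hA : 2 ≤ Fintype.card 𝒜) (D i : ℕ) (hD : 1 ≤ D) (hi : 1 ≤ i) (x : ℤ → 𝒜)
    (l : ℕ) (hl : 1 ≤ l) (hlD : l ≤ D)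
    (hpos : ∀ j ≤ l, 0 < ∑ q, cnt x D i (sfx x (i : ℤ) j) q) :
    (∀ a : 𝒜, (cnt x D i (sfx x (i : ℤ) l) a : ℝ) =
        gfwd x D i (sfx x (i : ℤ) l) a *
          (∏ j ∈ Finset.range l, gbwd x D i (sfx x (i : ℤ) j) (x ((i : ℤ) - (j : ℤ)))) * i) ∧
    ∑ q, cnt x D i (sfx x (i : ℤ) 0) q = i := by
  refine ⟨fun a => ?_, by rw [sfx_zero, sum_cnt_nil]⟩
  have hne : (∑ q, (cnt x D i (sfx x (i : ℤ) l) q : ℝ)) ≠ 0 := by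
    exact_mod_cast (hpos l le_rfl).ne'
  rw [mul_assoc, prod_gbwd_mul_eq_sum_cnt x D i l fun j hj => hpos j hj.le, gfwd,
    div_mul_cancel₀ _ hne]
end

section
/- (Finite-memory context-extension layer.) Let M ≥ 1 and E ≥ (M+1)A + 3. There exist matrices W_{Q,m}, W_{K,m}, W_{V,m} ∈ ℝ^{E×E} for m = 1,…,M and an output matrix W_O (all independent of the input sequence) such that, for every sequence x_1,…,x_n over 𝒜 with n ≤ N embedded as 𝐡_i = (𝐱_i; 0; pos_i) ∈ ℝ^E and every position i with M < i ≤ n, the multi-head attention output with residual connection, computed with key matrices scaled by a temperature c (i.e., using c·W_{K,m}), converges as c → ∞ to the stacked suffix embedding: lim_{c→∞} (𝐚_i + 𝐡_i) = (𝐱_i; 𝐱_{i−1}; …; 𝐱_{i−M}; 0; pos_i). Explicitly, one may take the m-th head query to be the rotated positional embedding pos_{i−m}, the key at position j to be pos_j, and the value at position j to be 𝐱_j placed in the (m+1)-st block of A coordinates. -/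
open scoped Classical

noncomputable section

variable {𝒜 : Type*}

/-- The input embedding `𝐡_i = (𝐱_i; 0; pos_i) ∈ ℝ^E`: the one-hot encoding of `x_i` (zero for
`i ≤ 0`) in the first `A` coordinates, the sinusoidal positional embedding
`pos_i = (1, cos(iπ/N), sin(iπ/N))` in the last three coordinates, and zeros elsewhere. -/
def embed1 [Fintype 𝒜] [DecidableEq 𝒜] (x : ℤ → 𝒜) (N E : ℕ) (i : ℤ) : Fin E → ℝ :=
  fun e =>
    if (e : ℕ) < Fintype.card 𝒜 then
      (if 1 ≤ i ∧ ((Fintype.equivFin 𝒜 (x i) : ℕ) = (e : ℕ)) then 1 else 0)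
    else if (e : ℕ) = E - 3 then 1
    else if (e : ℕ) = E - 2 then Real.cos (i * Real.pi / N)
    else if (e : ℕ) = E - 1 then Real.sin (i * Real.pi / N)
    else 0

/-- The attention score `⟨W_K 𝐡_j, W_Q 𝐡_i⟩`. -/
def attnScore (E : ℕ) (WQ WK : Matrix (Fin E) (Fin E) ℝ) (H : ℤ → Fin E → ℝ)
    (i j : ℤ) : ℝ :=
  ∑ e, WK.mulVec (H j) e * WQ.mulVec (H i) e

/-- The output at position `i` of a single causal attention head whose key matrix is scaled by
the temperature `c`:  the softmax over positions `1 ≤ j ≤ i` of the scores `c·⟨W_K 𝐡_j, W_Q 𝐡_i⟩`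
applied to the values `W_V 𝐡_j`. -/
def headOut (E : ℕ) (WQ WK WV : Matrix (Fin E) (Fin E) ℝ) (H : ℤ → Fin E → ℝ)
    (c : ℝ) (i : ℤ) : Fin E → ℝ := fun e =>
  (∑ j ∈ Finset.Icc 1 i, Real.exp (c * attnScore E WQ WK H i j) * WV.mulVec (H j) e) /
    ∑ j ∈ Finset.Icc 1 i, Real.exp (c * attnScore E WQ WK H i j)

/-- The output of a multi-head attention layer with `M` heads and output matrix `W_O`. -/
def mhaOut (E M : ℕ) (WQ WK WV : Fin M → Matrix (Fin E) (Fin E) ℝ)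
    (WO : Matrix (Fin E) (Fin M × Fin E) ℝ) (H : ℤ → Fin E → ℝ) (c : ℝ) (i : ℤ) :
    Fin E → ℝ := fun e =>
  ∑ p : Fin M × Fin E, WO e p * headOut E (WQ p.1) (WK p.1) (WV p.1) H c i p.2

/-- The stacked suffix embedding `(𝐱_i; 𝐱_{i-1}; …; 𝐱_{i-M}; 0; pos_i) ∈ ℝ^E`: for
`e < (M+1)·A`, block `m = e / A` carries the one-hot encoding of `x_{i-m}` (zero for
`i - m ≤ 0`); the last three coordinates carry `pos_i`; the rest are zero. -/
def stackEmb [Fintype 𝒜] [DecidableEq 𝒜] (x : ℤ → 𝒜) (N E M : ℕ) (i : ℤ) : Fin E → ℝ :=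
  fun e =>
    if (e : ℕ) < (M + 1) * Fintype.card 𝒜 then
      (if 1 ≤ i - ((e : ℕ) / Fintype.card 𝒜 : ℕ) ∧
          ((Fintype.equivFin 𝒜 (x (i - ((e : ℕ) / Fintype.card 𝒜 : ℕ))) : ℕ)
            = (e : ℕ) % Fintype.card 𝒜) then 1 else 0)
    else if (e : ℕ) = E - 3 then 1
    else if (e : ℕ) = E - 2 then Real.cos (i * Real.pi / N)
    else if (e : ℕ) = E - 1 then Real.sin (i * Real.pi / N)
    else 0

end

open Filter Topology

/-- A softmax average concentrates on the unique maximiser of the scores as the inverse temperature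
tends to infinity. -/
theorem tendsto_softmax_average {ι : Type*} (s : Finset ι) (u v : ι → ℝ) {k : ι} (hk : k ∈ s)
    (hu : ∀ j ∈ s, j ≠ k → u j < u k) :
    Tendsto (fun c : ℝ => (∑ j ∈ s, Real.exp (c * u j) * v j) / ∑ j ∈ s, Real.exp (c * u j))
      atTop (𝓝 (v k)) := by
  have tendsto_sum (w : ι → ℝ) :
      Tendsto (fun c : ℝ => ∑ j ∈ s, Real.exp (c * (u j - u k)) * w j) atTop (𝓝 (w k)) := by
    have hsum : ∑ j ∈ s, (if j = k then w j else 0) = w k := by simp [hk]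
    rw [← hsum]
    refine tendsto_finsetSum _ fun j hj => ?_
    by_cases h : j = k
    · simp [h]
    · have hneg : u j - u k < 0 := sub_neg.mpr (hu j hj h)
      simpa [h] using
        (Real.tendsto_exp_atBot.comp (tendsto_id.atTop_mul_const_of_neg hneg)).mul_const (w j)
  have hquot := (tendsto_sum v).div (tendsto_sum fun _ => 1) one_ne_zero
  rw [div_one] at hquot
  refine hquot.congr fun c => ?_
  have hshift (j : ι) :
      Real.exp (c * (u j - u k)) = Real.exp (-(c * u k)) * Real.exp (c * u j) := by
    rw [← Real.exp_add]; congr 1; ring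
  simp only [Pi.div_apply, hshift, mul_one, mul_assoc, ← Finset.mul_sum]
  exact mul_div_mul_left _ _ (Real.exp_ne_zero _)

/-- The matrix acting as the rotation by `-φ` on the coordinate plane spanned by `a` and `b`, and as
zero on the other coordinates. -/
noncomputable def planeRotation {ι : Type*} [DecidableEq ι] (a b : ι) (φ : ℝ) : Matrix ι ι ℝ :=
  Matrix.single a a (Real.cos φ) + Matrix.single a b (Real.sin φ) +
    (Matrix.single b a (-Real.sin φ) + Matrix.single b b (Real.cos φ))

theorem dotProduct_planeRotation_mulVec {ι : Type*} [Fintype ι] [DecidableEq ι] (a b : ι)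
    (φ : ℝ) (v w : ι → ℝ) :
    v ⬝ᵥ (planeRotation a b φ).mulVec w =
      v a * (Real.cos φ * w a + Real.sin φ * w b) +
        v b * (-Real.sin φ * w a + Real.cos φ * w b) := by
  simp only [planeRotation, Matrix.add_mulVec, Matrix.single_mulVec, dotProduct_add]
  simp only [dotProduct, Function.update_apply, Pi.zero_apply, mul_ite, mul_zero,
    Finset.sum_ite_eq', Finset.mem_univ, if_true]
  ring

theorem cos_int_mul_pi_div_lt_one {N : ℕ} {d : ℤ} (hd : d ≠ 0) (hdN : |d| < N) :
    Real.cos (d * Real.pi / N) < 1 := by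
  refine lt_of_le_of_ne (Real.cos_le_one _) fun h => hd ?_
  have hN : (0 : ℝ) < N := by exact_mod_cast (abs_nonneg d).trans_lt hdN
  obtain ⟨h₁, h₂⟩ := abs_lt.mp (show |(d : ℝ)| < N by exact_mod_cast hdN)
  have hpi := Real.pi_pos
  have hzero : (d : ℝ) * Real.pi / N = 0 :=
    (Real.cos_eq_one_iff_of_lt_of_lt (by rw [lt_div_iff₀ hN]; nlinarith)
      (by rw [div_lt_iff₀ hN]; nlinarith)).mp h
  simpa [hN.ne', hpi.ne'] using hzero

section

variable {𝒜 : Type*} [Fintype 𝒜] [DecidableEq 𝒜]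

theorem attnScore_planeRotation (x : ℤ → 𝒜) {N E : ℕ} (hE : Fintype.card 𝒜 + 3 ≤ E)
    {a b : Fin E} (ha : (a : ℕ) = E - 2) (hb : (b : ℕ) = E - 1) (m i j : ℤ) :
    attnScore E (planeRotation a b (m * Real.pi / N)) 1 (embed1 x N E) i j =
      Real.cos ((i - m - j : ℤ) * Real.pi / N) := by
  have hcos (l : ℤ) : embed1 x N E l a = Real.cos (l * Real.pi / N) := by
    rw [embed1, if_neg (by omega), if_neg (by omega), if_pos ha]
  have hsin (l : ℤ) : embed1 x N E l b = Real.sin (l * Real.pi / N) := by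
    rw [embed1, if_neg (by omega), if_neg (by omega), if_neg (by omega), if_pos hb]
  have hangle : ((i - m - j : ℤ) : ℝ) * Real.pi / N =
      i * Real.pi / N - m * Real.pi / N - j * Real.pi / N := by push_cast; ring
  have hdot := dotProduct_planeRotation_mulVec a b (m * Real.pi / N) (embed1 x N E j)
    (embed1 x N E i)
  simp only [attnScore, Matrix.one_mulVec]
  rw [dotProduct] at hdot
  rw [hdot, hcos, hcos, hsin, hsin, hangle]
  simp only [Real.cos_sub, Real.sin_sub]
  ring

theorem tendsto_headOut_planeRotation (x : ℤ → 𝒜) {N E : ℕ} (hE : Fintype.card 𝒜 + 3 ≤ E)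
    {a b : Fin E} (ha : (a : ℕ) = E - 2) (hb : (b : ℕ) = E - 1) {m i : ℤ} (hm : 0 ≤ m)
    (hmi : m < i) (hi : i ≤ N) (e : Fin E) :
    Tendsto (fun c => headOut E (planeRotation a b (m * Real.pi / N)) 1 1 (embed1 x N E) c i e)
      atTop (𝓝 (embed1 x N E (i - m) e)) := by
  simp only [headOut, Matrix.one_mulVec, attnScore_planeRotation x hE ha hb]
  refine tendsto_softmax_average _ (fun j : ℤ => Real.cos ((i - m - j : ℤ) * Real.pi / N))
    (fun j => embed1 x N E j e) (Finset.mem_Icc.mpr (by omega)) fun j hj hne => ?_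
  rw [Finset.mem_Icc] at hj
  have hlt := cos_int_mul_pi_div_lt_one (N := N) (d := i - m - j) (by omega)
    (abs_lt.mpr (by omega))
  simpa using hlt

/-- The output matrix moving the first `A` coordinates of head `m` into block `m + 1`. -/
noncomputable def blockPlacement (A E M : ℕ) : Matrix (Fin E) (Fin M × Fin E) ℝ :=
  fun e p => if (p.1 : ℕ) + 1 = e / A ∧ (p.2 : ℕ) = e % A then 1 else 0

theorem sum_blockPlacement_add_embed1 (x : ℤ → 𝒜) {M N E : ℕ} (hA : 0 < Fintype.card 𝒜)
    (hE : (M + 1) * Fintype.card 𝒜 + 3 ≤ E) (i : ℤ) (e : Fin E) :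
    ∑ p : Fin M × Fin E,
        blockPlacement (Fintype.card 𝒜) E M e p * embed1 x N E (i - ((p.1 : ℕ) + 1 : ℤ)) p.2 +
      embed1 x N E i e = stackEmb x N E M i e := by
  have hcard : Fintype.card 𝒜 ≤ (M + 1) * Fintype.card 𝒜 := Nat.le_mul_of_pos_left _ M.succ_pos
  by_cases hblock : Fintype.card 𝒜 ≤ e ∧ (e : ℕ) < (M + 1) * Fintype.card 𝒜
  · obtain ⟨hle, hlt⟩ := hblock
    have hdivpos : 0 < (e : ℕ) / Fintype.card 𝒜 := Nat.div_pos hle hA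
    have hdivlt : (e : ℕ) / Fintype.card 𝒜 < M + 1 := (Nat.div_lt_iff_lt_mul hA).mpr hlt
    have hmod : (e : ℕ) % Fintype.card 𝒜 < Fintype.card 𝒜 := Nat.mod_lt _ hA
    have hres : embed1 x N E i e = 0 := by
      rw [embed1, if_neg (by omega), if_neg (by omega), if_neg (by omega), if_neg (by omega)]
    rw [hres, add_zero, Finset.sum_eq_single
      ((⟨e / Fintype.card 𝒜 - 1, by omega⟩, ⟨e % Fintype.card 𝒜, by omega⟩) : Fin M × Fin E)]
    · have hsucc : (e : ℕ) / Fintype.card 𝒜 - 1 + 1 = e / Fintype.card 𝒜 := by omega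
      have hidx : i - (((e / Fintype.card 𝒜 - 1 : ℕ) : ℤ) + 1) =
          i - ((e / Fintype.card 𝒜 : ℕ) : ℤ) := by omega
      rw [blockPlacement, if_pos ⟨hsucc, rfl⟩, one_mul, embed1, if_pos hmod, stackEmb, if_pos hlt]
      simp only [hidx]
    · rintro ⟨m, k⟩ - hne
      rw [blockPlacement, if_neg, zero_mul]
      rintro ⟨hm, hk⟩
      refine hne (Prod.ext (Fin.ext ?_) (Fin.ext hk))
      dsimp only at hm ⊢
      omega
    · simp
  · have hsum : ∑ p : Fin M × Fin E, blockPlacement (Fintype.card 𝒜) E M e p *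
        embed1 x N E (i - ((p.1 : ℕ) + 1 : ℤ)) p.2 = 0 := by
      refine Finset.sum_eq_zero fun p _ => ?_
      rw [blockPlacement, if_neg, zero_mul]
      rintro ⟨hp, -⟩
      refine hblock ⟨?_, ?_⟩
      · by_contra hlt
        rw [Nat.div_eq_of_lt (not_le.mp hlt)] at hp
        omega
      · rw [← Nat.div_lt_iff_lt_mul hA]
        omega
    rw [hsum, zero_add, embed1, stackEmb]
    by_cases hlt : (e : ℕ) < Fintype.card 𝒜
    · simp [hlt, hlt.trans_le hcard, Nat.div_eq_of_lt hlt, Nat.mod_eq_of_lt hlt]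
    · rw [if_neg hlt, if_neg (show ¬ (e : ℕ) < (M + 1) * Fintype.card 𝒜 from fun h =>
        hblock ⟨not_lt.mp hlt, h⟩)]

end

/-- Finite-memory context-extension layer: there exist query, key and value
matrices for `M` heads and an output matrix, independent of the input sequence, such that for
every sequence over `𝒜` of length `n ≤ N` and every position `M < i ≤ n`, the multi-head
attention output with residual connection, with key matrices scaled by a temperature `c`,
converges as `c → ∞` to the stacked suffix embedding `(𝐱_i; 𝐱_{i-1}; …; 𝐱_{i-M}; 0; pos_i)`. -/
theorem context_extension_layer_exists {𝒜 : Type*} [Fintype 𝒜] [DecidableEq 𝒜]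
    (hA : 2 ≤ Fintype.card 𝒜) (M N E : ℕ) (hM : 1 ≤ M) (hN : 1 ≤ N)
    (hE : (M + 1) * Fintype.card 𝒜 + 3 ≤ E) :
    ∃ (WQ WK WV : Fin M → Matrix (Fin E) (Fin E) ℝ)
      (WO : Matrix (Fin E) (Fin M × Fin E) ℝ),
      ∀ (x : ℤ → 𝒜) (n : ℤ), n ≤ (N : ℤ) → ∀ i : ℤ, (M : ℤ) < i → i ≤ n →
        Filter.Tendsto
          (fun c : ℝ => fun e : Fin E =>
            mhaOut E M WQ WK WV WO (embed1 x N E) c i e + embed1 x N E i e)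
          Filter.atTop (nhds (stackEmb x N E M i)) := by
  have hcard : Fintype.card 𝒜 ≤ (M + 1) * Fintype.card 𝒜 := Nat.le_mul_of_pos_left _ M.succ_pos
  refine ⟨fun m => planeRotation ⟨E - 2, by omega⟩ ⟨E - 1, by omega⟩
    (((m : ℕ) + 1 : ℤ) * Real.pi / N), fun _ => 1, fun _ => 1,
    blockPlacement (Fintype.card 𝒜) E M, fun x n hn i hMi hin => ?_⟩
  refine tendsto_pi_nhds.mpr fun e => ?_
  rw [← sum_blockPlacement_add_embed1 x (by omega) hE i e]
  refine Tendsto.add_const _ (tendsto_finsetSum _ fun p _ => Tendsto.const_mul _ ?_)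
  have hp := p.1.isLt
  exact_mod_cast tendsto_headOut_planeRotation x (by omega) rfl rfl (by omega)
    (show ((p.1 : ℕ) + 1 : ℤ) < i by omega) (hin.trans hn) p.2
end
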